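/- arXiv:1501.04576 — 8 statements merged into one kernel-verified Lean document; each statement's English description precedes it below -/
import Mathlib

section
/- Let c > 0. Then for every r ∈ ℝ one has 2·(cos(2cr) − 3) + 2·sin(cr)·sin(2cr) + 4 = −8·sin²(cr/2)·sin²(cr), and there exists r ∈ (0, π/c) at which this quantity is nonzero. Consequently, with domain warping function f(r) = (1/c)·sin(cr) and target profile h(α) = α, the reduced biharmonicity condition for conformal rotationally symmetric maps from S⁴(c²) to ℝ⁴ cannot hold identically on (0, π/c), so there is no rotationally symmetric proper biharmonic conformal diffeomorphism in this case. -/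
/-- For `c > 0`, the reduced biharmonicity expression for conformal
rotationally symmetric maps from `S⁴(c²)` to `ℝ⁴` equals `−8·sin²(cr/2)·sin²(cr)`;
it is nonzero at some `r ∈ (0, π/c)`, hence cannot vanish identically on `(0, π/c)`:
no rotationally symmetric proper biharmonic conformal diffeomorphism exists here. -/
theorem stmt_4 (c : ℝ) (hc : 0 < c) :
    (∀ r : ℝ,
      2 * (Real.cos (2 * c * r) - 3) + 2 * Real.sin (c * r) * Real.sin (2 * c * r) + 4
        = -8 * Real.sin (c * r / 2) ^ 2 * Real.sin (c * r) ^ 2) ∧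
    (∃ r ∈ Set.Ioo 0 (Real.pi / c),
      2 * (Real.cos (2 * c * r) - 3) + 2 * Real.sin (c * r) * Real.sin (2 * c * r) + 4 ≠ 0) ∧
    ¬ (∀ r ∈ Set.Ioo 0 (Real.pi / c),
      2 * (Real.cos (2 * c * r) - 3) + 2 * Real.sin (c * r) * Real.sin (2 * c * r) + 4 = 0) := by
  have identity : ∀ r : ℝ,
      2 * (Real.cos (2 * c * r) - 3) + 2 * Real.sin (c * r) * Real.sin (2 * c * r) + 4
        = -8 * Real.sin (c * r / 2) ^ 2 * Real.sin (c * r) ^ 2 := by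
    intro r
    have half : Real.cos (c * r) = 1 - 2 * Real.sin (c * r / 2) ^ 2 := by
      have h := Real.cos_two_mul (c * r / 2)
      rw [show 2 * (c * r / 2) = c * r by ring, Real.cos_sq'] at h
      linarith
    rw [mul_assoc 2 c r, Real.cos_two_mul, Real.sin_two_mul, Real.cos_sq']
    linear_combination 4 * Real.sin (c * r) ^ 2 * half
  have nonzero : ∃ r ∈ Set.Ioo 0 (Real.pi / c),
      2 * (Real.cos (2 * c * r) - 3) + 2 * Real.sin (c * r) * Real.sin (2 * c * r) + 4 ≠ 0 := by
    refine ⟨Real.pi / 2 / c, ⟨by positivity, by gcongr; linarith [Real.pi_pos]⟩, ?_⟩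
    have double : 2 * c * (Real.pi / 2 / c) = Real.pi := by field_simp
    rw [double, Real.cos_pi, Real.sin_pi]
    norm_num
  refine ⟨identity, nonzero, fun h => ?_⟩
  obtain ⟨r, hr, hne⟩ := nonzero
  exact hne (h r hr)
end

section
/- Let c > 0. Then for every r ∈ ℝ one has 2·(cosh(2cr) − 3) − 2·sinh(cr)·sinh(2cr) + 4 = −8·sinh²(cr/2)·sinh²(cr), and this quantity is nonzero for every r > 0. Consequently, with domain warping function f(r) = (1/c)·sinh(cr) and target profile h(α) = α, the reduced biharmonicity condition for conformal rotationally symmetric maps from H⁴(−c²) to ℝ⁴ cannot hold on (0,∞), so there is no rotationally symmetric proper biharmonic conformal diffeomorphism in this case. -/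
/-- For `c > 0`, the reduced biharmonicity expression for conformal
rotationally symmetric maps from `H⁴(−c²)` to `ℝ⁴` equals `−8·sinh²(cr/2)·sinh²(cr)`,
which is nonzero for every `r > 0`; hence the condition cannot hold on `(0,∞)` and no
rotationally symmetric proper biharmonic conformal diffeomorphism exists in this case. -/
theorem stmt_9 (c : ℝ) (hc : 0 < c) :
    (∀ r : ℝ,
      2 * (Real.cosh (2 * c * r) - 3) - 2 * Real.sinh (c * r) * Real.sinh (2 * c * r) + 4
        = -8 * Real.sinh (c * r / 2) ^ 2 * Real.sinh (c * r) ^ 2) ∧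
    (∀ r : ℝ, 0 < r →
      2 * (Real.cosh (2 * c * r) - 3) - 2 * Real.sinh (c * r) * Real.sinh (2 * c * r) + 4 ≠ 0) ∧
    ¬ (∀ r : ℝ, 0 < r →
      2 * (Real.cosh (2 * c * r) - 3) - 2 * Real.sinh (c * r) * Real.sinh (2 * c * r) + 4 = 0) := by
  have key : ∀ r : ℝ,
      2 * (Real.cosh (2 * c * r) - 3) - 2 * Real.sinh (c * r) * Real.sinh (2 * c * r) + 4
        = -8 * Real.sinh (c * r / 2) ^ 2 * Real.sinh (c * r) ^ 2 := by
    intro r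
    have half : Real.cosh (c * r) = 1 + 2 * Real.sinh (c * r / 2) ^ 2 := by
      have h := Real.cosh_two_mul (c * r / 2)
      rw [mul_div_cancel₀ (c * r) two_ne_zero, Real.cosh_sq] at h
      linarith
    rw [mul_assoc 2 c r, Real.cosh_two_mul, Real.sinh_two_mul, Real.cosh_sq]
    linear_combination -4 * Real.sinh (c * r) ^ 2 * half
  have ne : ∀ r : ℝ, 0 < r →
      2 * (Real.cosh (2 * c * r) - 3) - 2 * Real.sinh (c * r) * Real.sinh (2 * c * r) + 4 ≠ 0 := by
    intro r hr
    have half_pos : 0 < Real.sinh (c * r / 2) := Real.sinh_pos_iff.2 (by positivity)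
    have full_pos : 0 < Real.sinh (c * r) := Real.sinh_pos_iff.2 (by positivity)
    rw [key r]
    exact mul_ne_zero (mul_ne_zero (by norm_num) (pow_ne_zero 2 half_pos.ne'))
      (pow_ne_zero 2 full_pos.ne')
  exact ⟨key, ne, fun h => ne 1 one_pos (h 1 one_pos)⟩
end

section
/- Let h : ℝ → ℝ be of class C³ and set q(y) = h(y)·h'(y). Let a < b be real numbers and let β : [a, b] → ℝ be differentiable with β'(t) = h(β(t)) for all t ∈ [a, b]. Then for every C² function V : [a, b] → ℝ, the function s ↦ (1/2)·∫_a^b [ β''(t) + s·V''(t) + 2·(β'(t) + s·V'(t)) − 3·q(β(t) + s·V(t)) ]² dt is twice differentiable at s = 0, and its second derivative at s = 0 equals ∫_a^b { [ V''(t) + 2·V'(t) − 3·q'(β(t))·V(t) ]² + 6·q''(β(t))·h(β(t))·( h'(β(t)) − 1 )·V(t)² } dt. -/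
open Set in
/-- Differentiation under the integral sign over a compact interval, for an integrand which is
jointly continuous together with its derivative in the parameter. -/
theorem hasDerivAt_intervalIntegral_of_continuousOn {a b : ℝ} (hab : a ≤ b) {G G' : ℝ → ℝ → ℝ}
    (hG : ContinuousOn (fun p : ℝ × ℝ => G p.1 p.2) (univ ×ˢ Icc a b))
    (hG' : ContinuousOn (fun p : ℝ × ℝ => G' p.1 p.2) (univ ×ˢ Icc a b))
    (hd : ∀ s, ∀ t ∈ Icc a b, HasDerivAt (fun s => G s t) (G' s t) s) (s₀ : ℝ) :
    HasDerivAt (fun s => ∫ t in a..b, G s t) (∫ t in a..b, G' s₀ t) s₀ := by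
  have slice {g : ℝ → ℝ → ℝ} (hg : ContinuousOn (fun p : ℝ × ℝ => g p.1 p.2) (univ ×ˢ Icc a b))
      (s : ℝ) : IntervalIntegrable (g s) MeasureTheory.volume a b := by
    apply ContinuousOn.intervalIntegrable
    rw [uIcc_of_le hab]
    exact hg.comp (f := fun t => (s, t)) (by fun_prop) fun t ht => ⟨mem_univ _, ht⟩
  obtain ⟨C, hC⟩ := ((isCompact_closedBall s₀ 1).prod isCompact_Icc).exists_bound_of_continuousOn
    (hG'.mono (prod_mono_left (subset_univ (Metric.closedBall s₀ 1))))
  have hsub : uIoc a b ⊆ Icc a b := by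
    rw [uIoc_of_le hab]
    exact Ioc_subset_Icc_self
  exact (intervalIntegral.hasDerivAt_integral_of_dominated_loc_of_deriv_le
    (bound := fun _ => C) (Metric.ball_mem_nhds s₀ one_pos)
    (.of_forall fun s => (intervalIntegrable_iff.1 (slice hG s)).aestronglyMeasurable) (slice hG s₀)
    (intervalIntegrable_iff.1 (slice hG' s₀)).aestronglyMeasurable
    (.of_forall fun t ht s hs => hC (s, t) ⟨Metric.ball_subset_closedBall hs, hsub ht⟩)
    intervalIntegrable_const (.of_forall fun t ht s _ => hd s t (hsub ht))).2

/-- (Equivariant second variation at a conformal critical point.)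
Let `h` be `C³`, `q = h·h'`, and let `β : [a,b] → ℝ` satisfy the conformality equation
`β' = h(β)` (with second derivative `β''`). Then for every `C²` function `V` on `[a,b]`,
the reduced bienergy of the variation `β + sV`,
`F(s) = (1/2)·∫_a^b [β'' + sV'' + 2(β' + sV') − 3q(β + sV)]² dt`,
is twice differentiable at `s = 0` and its second derivative there equals
`∫_a^b { [V'' + 2V' − 3q'(β)V]² + 6q''(β)h(β)(h'(β) − 1)V² } dt`. -/
theorem stmt_14 (h : ℝ → ℝ) (hh : ContDiff ℝ 3 h)
    (q : ℝ → ℝ) (hq : ∀ y : ℝ, q y = h y * deriv h y)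
    (a b : ℝ) (hab : a < b)
    (β β' β'' : ℝ → ℝ)
    (hβ : ∀ t ∈ Set.Icc a b, HasDerivWithinAt β (β' t) (Set.Icc a b) t)
    (hconf : ∀ t ∈ Set.Icc a b, β' t = h (β t))
    (hβ' : ∀ t ∈ Set.Icc a b, HasDerivWithinAt β' (β'' t) (Set.Icc a b) t)
    (V V' V'' : ℝ → ℝ)
    (hV : ∀ t ∈ Set.Icc a b, HasDerivWithinAt V (V' t) (Set.Icc a b) t)
    (hV' : ∀ t ∈ Set.Icc a b, HasDerivWithinAt V' (V'' t) (Set.Icc a b) t)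
    (hVcont : ContinuousOn V'' (Set.Icc a b))
    (F : ℝ → ℝ)
    (hF : ∀ s : ℝ, F s = (1 / 2) *
      ∫ t in a..b,
        (β'' t + s * V'' t + 2 * (β' t + s * V' t) - 3 * q (β t + s * V t)) ^ 2) :
    DifferentiableAt ℝ (deriv F) 0 ∧
    deriv (deriv F) 0 =
      ∫ t in a..b,
        ((V'' t + 2 * V' t - 3 * deriv q (β t) * V t) ^ 2
          + 6 * deriv (deriv q) (β t) * h (β t) * (deriv h (β t) - 1) * (V t) ^ 2) := by
  have hq2 : ContDiff ℝ 2 q := by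
    rw [show q = fun y => h y * deriv h y from funext hq]
    exact (hh.of_le (by norm_num)).mul (ContDiff.deriv' (n := 2) (hh.of_le (by norm_num)))
  have hq1 : ContDiff ℝ 1 (deriv q) := ContDiff.deriv' (n := 1) (hq2.of_le (by norm_num))
  have hqc : Continuous q := hq2.continuous
  have hq'c : Continuous (deriv q) := hq1.continuous
  have hq''c : Continuous (deriv (deriv q)) := hq1.continuous_deriv le_rfl
  have hqd (y : ℝ) : HasDerivAt q (deriv q y) y :=
    (hq2.differentiable (by norm_num) y).hasDerivAt
  have hq'd (y : ℝ) : HasDerivAt (deriv q) (deriv (deriv q) y) y :=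
    (hq1.differentiable (by norm_num) y).hasDerivAt
  have hβ''q (t : ℝ) (ht : t ∈ Set.Icc a b) : β'' t = q (β t) := by
    have hcomp : HasDerivWithinAt (fun t => h (β t)) (deriv h (β t) * β' t) (Set.Icc a b) t :=
      ((hh.differentiable (by norm_num) (β t)).hasDerivAt).comp_hasDerivWithinAt t (hβ t ht)
    rw [((uniqueDiffOn_Icc hab).uniqueDiffWithinAt ht).eq_deriv _ (hβ' t ht)
      (hcomp.congr hconf (hconf t ht)), hconf t ht, hq, mul_comm]
  have hβc : ContinuousOn β (Set.Icc a b) := fun t ht => (hβ t ht).continuousWithinAt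
  have hβ'c : ContinuousOn β' (Set.Icc a b) := fun t ht => (hβ' t ht).continuousWithinAt
  have hβ''c : ContinuousOn β'' (Set.Icc a b) := (hqc.comp_continuousOn hβc).congr hβ''q
  have hVc : ContinuousOn V (Set.Icc a b) := fun t ht => (hV t ht).continuousWithinAt
  have hV'c : ContinuousOn V' (Set.Icc a b) := fun t ht => (hV' t ht).continuousWithinAt
  have lift {g : ℝ → ℝ} (hg : ContinuousOn g (Set.Icc a b)) :
      ContinuousOn (fun p : ℝ × ℝ => g p.2) (Set.univ ×ˢ Set.Icc a b) :=
    hg.comp continuousOn_snd fun p hp => hp.2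
  have lβ := lift hβc
  have lβ' := lift hβ'c
  have lβ'' := lift hβ''c
  have lV := lift hVc
  have lV' := lift hV'c
  have lV'' := lift hVcont
  have l1 : ContinuousOn (fun p : ℝ × ℝ => p.1) (Set.univ ×ˢ Set.Icc a b) := continuousOn_fst
  have lu : ContinuousOn (fun p : ℝ × ℝ => β p.2 + p.1 * V p.2) (Set.univ ×ˢ Set.Icc a b) :=
    lβ.add (l1.mul lV)
  have lq := hqc.comp_continuousOn lu
  have lq' := hq'c.comp_continuousOn lu
  have lq'' := hq''c.comp_continuousOn lu
  simp only [Function.comp_def] at lq lq' lq''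
  let T (s t : ℝ) : ℝ := β'' t + s * V'' t + 2 * (β' t + s * V' t) - 3 * q (β t + s * V t)
  let T' (s t : ℝ) : ℝ := V'' t + 2 * V' t - 3 * (deriv q (β t + s * V t) * V t)
  let T'' (s t : ℝ) : ℝ := -(3 * (deriv (deriv q) (β t + s * V t) * V t * V t))
  have lT : ContinuousOn (fun p : ℝ × ℝ => T p.1 p.2) (Set.univ ×ˢ Set.Icc a b) :=
    ((lβ''.add (l1.mul lV'')).add ((lβ'.add (l1.mul lV')).const_mul 2)).sub (lq.const_mul 3)
  have lT' : ContinuousOn (fun p : ℝ × ℝ => T' p.1 p.2) (Set.univ ×ˢ Set.Icc a b) :=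
    (lV''.add (lV'.const_mul 2)).sub ((lq'.mul lV).const_mul 3)
  have lT'' : ContinuousOn (fun p : ℝ × ℝ => T'' p.1 p.2) (Set.univ ×ˢ Set.Icc a b) :=
    (((lq''.mul lV).mul lV).const_mul 3).neg
  have dlin (c v s : ℝ) : HasDerivAt (fun s => c + s * v) v s := by
    simpa using ((hasDerivAt_id s).mul_const v).const_add c
  have dT (s t : ℝ) : HasDerivAt (fun s => T s t) (T' s t) s :=
    ((dlin _ _ s).add ((dlin _ _ s).const_mul 2)).sub
      (((hqd _).comp s (dlin (β t) (V t) s)).const_mul 3)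
  have dT' (s t : ℝ) : HasDerivAt (fun s => T' s t) (T'' s t) s :=
    ((((hq'd _).comp s (dlin (β t) (V t) s)).mul_const (V t)).const_mul 3).const_sub _
  have hF' : deriv F = fun s => ∫ t in a..b, T s t * T' s t := by
    funext s
    have key := (hasDerivAt_intervalIntegral_of_continuousOn hab.le
      (G := fun s t => T s t ^ 2) (G' := fun s t => 2 * (T s t * T' s t))
      (by fun_prop) (by fun_prop)
      (fun s t _ => ((dT s t).pow 2).congr_deriv (by push_cast; ring)) s).const_mul (1 / 2)
    rw [show F = fun s => (1 / 2) * ∫ t in a..b, T s t ^ 2 from funext hF, key.deriv,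
      intervalIntegral.integral_const_mul]
    ring
  have hF'' := hasDerivAt_intervalIntegral_of_continuousOn hab.le
    (G := fun s t => T s t * T' s t) (G' := fun s t => T' s t * T' s t + T s t * T'' s t)
    (by fun_prop) (by fun_prop) (fun s t _ => (dT s t).mul (dT' s t)) 0
  rw [← hF'] at hF''
  refine ⟨hF''.differentiableAt, hF''.deriv.trans (intervalIntegral.integral_congr ?_)⟩
  intro t ht
  rw [Set.uIcc_of_le hab.le] at ht
  simp only [T, T', T'', zero_mul, add_zero, hβ''q t ht, hconf t ht, hq (β t)]
  ring
end

section
/- Let c > 0, d > 0, set T = log(1/c²), and define β(t) = (2/d)·artanh(c²·e^t) for t < T. Let V : ℝ → ℝ be a C² function, not identically zero, with compact support contained in (−∞, T). Then ∫_{−∞}^{T} { [ V''(t) + 2·V'(t) − 3·cosh(2d·β(t))·V(t) ]² + 24·cosh(d·β(t))·sinh²(d·β(t))·( cosh(d·β(t)) − 1 )·V(t)² } dt > 0. -/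
/-- The inverse hyperbolic tangent, `artanh x = (1/2)·log((1+x)/(1−x))`. -/
noncomputable def artanh (x : ℝ) : ℝ := (1 / 2) * Real.log ((1 + x) / (1 - x))

theorem artanh_pos {x : ℝ} (h0 : 0 < x) (h1 : x < 1) : 0 < artanh x := by
  unfold artanh
  have : 1 < (1 + x) / (1 - x) := by
    rw [lt_div_iff₀ (by linarith)]
    linarith
  have := Real.log_pos this
  positivity

theorem continuousOn_artanh : ContinuousOn artanh (Set.Ioo 0 1) := by
  unfold artanh
  refine continuousOn_const.mul (ContinuousOn.log (ContinuousOn.div (by fun_prop) (by fun_prop) ?_) ?_)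
  · rintro x ⟨_, h1⟩
    linarith
  · rintro x ⟨h0, h1⟩
    have : 0 < 1 - x := by linarith
    positivity

/-- (Equivariant stability of the proper biharmonic conformal
diffeomorphism `B⁴(1/c²) → H⁴(−d²)`.) Let `c, d > 0`, `T = log(1/c²)`, and
`β(t) = (2/d)·artanh(c²·eᵗ)` for `t < T`. For every `C²` function `V`, not identically
zero, with compact support contained in `(−∞, T)`, the equivariant second variation
`∫_{−∞}^{T} { [V'' + 2V' − 3cosh(2dβ)V]² + 24cosh(dβ)sinh²(dβ)(cosh(dβ) − 1)V² } dt`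
is strictly positive. -/
theorem stmt_15 (c d : ℝ) (hc : 0 < c) (hd : 0 < d)
    (T : ℝ) (hT : T = Real.log (1 / c ^ 2))
    (β : ℝ → ℝ) (hβ : ∀ t : ℝ, t < T → β t = (2 / d) * artanh (c ^ 2 * Real.exp t))
    (V : ℝ → ℝ) (hV : ContDiff ℝ 2 V)
    (hVne : ∃ t : ℝ, V t ≠ 0)
    (hVsupp : HasCompactSupport V)
    (hVsub : tsupport V ⊆ Set.Iio T) :
    0 < ∫ t in Set.Iio T,
      ((deriv (deriv V) t + 2 * deriv V t - 3 * Real.cosh (2 * d * β t) * V t) ^ 2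
        + 24 * Real.cosh (d * β t) * Real.sinh (d * β t) ^ 2
            * (Real.cosh (d * β t) - 1) * (V t) ^ 2) := by
  have hx : ∀ t < T, c ^ 2 * Real.exp t ∈ Set.Ioo (0 : ℝ) 1 := by
    intro t ht
    refine ⟨by positivity, ?_⟩
    have h := Real.exp_lt_exp.2 ht
    rw [hT, Real.exp_log (by positivity), lt_div_iff₀ (by positivity)] at h
    linarith
  have hβpos : ∀ t < T, 0 < d * β t := by
    intro t ht
    rw [hβ t ht]
    have := artanh_pos (hx t ht).1 (hx t ht).2
    positivity
  have hβcont : ContinuousOn β (tsupport V) := by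
    have h : ContinuousOn (fun t => (2 / d) * artanh (c ^ 2 * Real.exp t)) (Set.Iio T) :=
      continuousOn_const.mul (continuousOn_artanh.comp (by fun_prop) hx)
    exact (h.congr hβ).mono hVsub
  have hV1 : ContDiff ℝ 1 (deriv V) := hV.deriv' (n := 1)
  have hV0c : Continuous V := hV.continuous
  have hV1c : Continuous (deriv V) := hV1.continuous
  have hV2c : Continuous (deriv (deriv V)) := hV1.continuous_deriv le_rfl
  have hweight : ∀ t < T, 0 < 24 * Real.cosh (d * β t) * Real.sinh (d * β t) ^ 2
      * (Real.cosh (d * β t) - 1) := by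
    intro t ht
    have h1 : 0 < Real.sinh (d * β t) := Real.sinh_pos_iff.2 (hβpos t ht)
    have h2 : 0 < Real.cosh (d * β t) - 1 :=
      sub_pos.2 (Real.one_lt_cosh.2 (hβpos t ht).ne')
    have h3 := Real.cosh_pos (d * β t)
    positivity
  rw [MeasureTheory.setIntegral_pos_iff_support_of_nonneg_ae]
  · have hopen : IsOpen (Function.support V) := hV0c.isOpen_support
    refine (hopen.measure_pos MeasureTheory.volume hVne).trans_le
      (MeasureTheory.measure_mono fun t ht => ?_)
    have htT : t < T := hVsub (subset_tsupport V ht)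
    refine ⟨ne_of_gt ?_, htT⟩
    exact add_pos_of_nonneg_of_pos (sq_nonneg _)
      (mul_pos (hweight t htT) (sq_pos_of_ne_zero ht))
  · filter_upwards [MeasureTheory.ae_restrict_mem measurableSet_Iio] with t ht
    exact add_nonneg (sq_nonneg _) (mul_nonneg (hweight t ht).le (sq_nonneg _))
  · have hcompact : IsCompact (tsupport V) := hVsupp
    refine MeasureTheory.IntegrableOn.of_forall_sdiff_eq_zero
      (s := tsupport V) (ContinuousOn.integrableOn_compact hcompact ?_) measurableSet_Iio ?_
    · have hcosh := Real.continuous_cosh.comp_continuousOn (continuousOn_const.mul hβcont :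
        ContinuousOn (fun t => d * β t) (tsupport V))
      have hsinh := Real.continuous_sinh.comp_continuousOn (continuousOn_const.mul hβcont :
        ContinuousOn (fun t => d * β t) (tsupport V))
      have hcosh2 := Real.continuous_cosh.comp_continuousOn (continuousOn_const.mul hβcont :
        ContinuousOn (fun t => 2 * d * β t) (tsupport V))
      simp only [Function.comp_def] at hcosh hsinh hcosh2
      fun_prop
    · rintro t ⟨_, ht⟩
      have h0 : V t = 0 := image_eq_zero_of_notMem_tsupport ht
      have ht1 : t ∉ tsupport (deriv V) := fun h => ht (tsupport_deriv_subset h)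
      have h1 : deriv V t = 0 := image_eq_zero_of_notMem_tsupport ht1
      have h2 : deriv (deriv V) t = 0 :=
        image_eq_zero_of_notMem_tsupport fun h => ht1 (tsupport_deriv_subset h)
      simp [h0, h1, h2]
end

section
/- Let c > 0, d > 0, set T = log(1/c²), and define β(t) = (2/d)·arctan(c²·e^t) for t ≤ T. Let V : (−∞, T] → ℝ be a C² function, not identically zero, with compact support, satisfying V(T) = 0 and V'(T) = 0. Then ∫_{−∞}^{T} { [ V''(t) + 2·V'(t) − 3·cos(2d·β(t))·V(t) ]² + 24·cos(d·β(t))·sin²(d·β(t))·( 1 − cos(d·β(t)) )·V(t)² } dt > 0. -/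
/-- (Equivariant stability, under Dirichlet boundary conditions, of the
proper biharmonic conformal solution into `S⁴(d²)`.) Let `c, d > 0`, `T = log(1/c²)`,
and `β(t) = (2/d)·arctan(c²·eᵗ)` for `t ≤ T`. For every `C²` function `V` with compact
support, not identically zero on `(−∞, T]`, satisfying the boundary conditions
`V(T) = 0` and `V'(T) = 0`, the equivariant second variation
`∫_{−∞}^{T} { [V'' + 2V' − 3cos(2dβ)V]² + 24cos(dβ)sin²(dβ)(1 − cos(dβ))V² } dt`
is strictly positive. -/
theorem stmt_16 (c d : ℝ) (hc : 0 < c) (hd : 0 < d)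
    (T : ℝ) (hT : T = Real.log (1 / c ^ 2))
    (β : ℝ → ℝ) (hβ : ∀ t : ℝ, t ≤ T → β t = (2 / d) * Real.arctan (c ^ 2 * Real.exp t))
    (V : ℝ → ℝ) (hV : ContDiff ℝ 2 V)
    (hVsupp : HasCompactSupport V)
    (hVne : ∃ t : ℝ, t ≤ T ∧ V t ≠ 0)
    (hVT : V T = 0) (hV'T : deriv V T = 0) :
    0 < ∫ t in Set.Iio T,
      ((deriv (deriv V) t + 2 * deriv V t - 3 * Real.cos (2 * d * β t) * V t) ^ 2
        + 24 * Real.cos (d * β t) * Real.sin (d * β t) ^ 2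
            * (1 - Real.cos (d * β t)) * (V t) ^ 2) := by
  set B : ℝ → ℝ := fun t => (2 / d) * Real.arctan (c ^ 2 * Real.exp t) with hB
  set F : ℝ → ℝ := fun t =>
    (deriv (deriv V) t + 2 * deriv V t - 3 * Real.cos (2 * d * B t) * V t) ^ 2
      + 24 * Real.cos (d * B t) * Real.sin (d * B t) ^ 2
          * (1 - Real.cos (d * B t)) * (V t) ^ 2 with hF
  have hcongr : Set.EqOn (fun t =>
      (deriv (deriv V) t + 2 * deriv V t - 3 * Real.cos (2 * d * β t) * V t) ^ 2
        + 24 * Real.cos (d * β t) * Real.sin (d * β t) ^ 2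
            * (1 - Real.cos (d * β t)) * (V t) ^ 2) F (Set.Iio T) := by
    intro t ht
    simp only [hF, hB, hβ t (le_of_lt ht)]
  rw [MeasureTheory.setIntegral_congr_fun measurableSet_Iio hcongr]
  have hV0 : Continuous V := hV.continuous
  have hdV : ContDiff ℝ 1 (deriv V) := hV.deriv' (n := 1)
  have hV1 : Continuous (deriv V) := hdV.continuous
  have hV2 : Continuous (deriv (deriv V)) := hdV.continuous_deriv le_rfl
  have hBc : Continuous B :=
    continuous_const.mul
      (Real.continuous_arctan.comp (continuous_const.mul Real.continuous_exp))
  have hFc : Continuous F := by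
    simp only [hF]
    fun_prop
  have hFsupp : HasCompactSupport F := by
    refine HasCompactSupport.of_support_subset_isCompact hVsupp fun t ht => ?_
    by_contra hmem
    have h0 : V t = 0 := image_eq_zero_of_notMem_tsupport hmem
    have hmem1 : t ∉ tsupport (deriv V) := fun h => hmem (tsupport_deriv_subset h)
    have h1 : deriv V t = 0 := image_eq_zero_of_notMem_tsupport hmem1
    have h2 : deriv (deriv V) t = 0 :=
      image_eq_zero_of_notMem_tsupport fun h => hmem1 (tsupport_deriv_subset h)
    exact ht (by simp [hF, h0, h1, h2])
  have hangle : ∀ t < T, 0 < d * B t ∧ d * B t < Real.pi / 2 := by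
    intro t ht
    have hdB : d * B t = 2 * Real.arctan (c ^ 2 * Real.exp t) := by
      simp only [hB]
      field_simp
    have hpos : 0 < c ^ 2 * Real.exp t := by positivity
    have hlt : c ^ 2 * Real.exp t < 1 := by
      have h : Real.exp t < 1 / c ^ 2 := by
        rw [← Real.exp_log (show 0 < 1 / c ^ 2 by positivity), ← hT]
        exact Real.exp_lt_exp.2 ht
      rw [lt_div_iff₀ (by positivity)] at h
      linarith
    have h1 := Real.arctan_pos.2 hpos
    have h2 := Real.arctan_strictMono hlt
    rw [Real.arctan_one] at h2
    rw [hdB]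
    constructor <;> linarith
  have hcoef : ∀ t < T, 0 < 24 * Real.cos (d * B t) * Real.sin (d * B t) ^ 2
      * (1 - Real.cos (d * B t)) := by
    intro t ht
    obtain ⟨h0, h1⟩ := hangle t ht
    have hcos : 0 < Real.cos (d * B t) := Real.cos_pos_of_mem_Ioo ⟨by linarith, h1⟩
    have hsin : 0 < Real.sin (d * B t) :=
      Real.sin_pos_of_pos_of_lt_pi h0 (by linarith [Real.pi_pos])
    have hcos1 : 0 < 1 - Real.cos (d * B t) := by
      nlinarith [Real.sin_sq_add_cos_sq (d * B t)]
    positivity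
  have hnonneg : ∀ t < T, 0 ≤ F t := fun t ht =>
    add_nonneg (sq_nonneg _) (mul_nonneg (hcoef t ht).le (sq_nonneg _))
  rw [MeasureTheory.setIntegral_pos_iff_support_of_nonneg_ae
    ((MeasureTheory.ae_restrict_iff' measurableSet_Iio).2 (Filter.Eventually.of_forall hnonneg))
    (hFc.integrable_of_hasCompactSupport hFsupp).integrableOn]
  obtain ⟨t₀, ht₀, hVt₀⟩ := hVne
  have hlt : t₀ < T := lt_of_le_of_ne ht₀ fun h => hVt₀ (h ▸ hVT)
  have hopen : IsOpen (Function.support F ∩ Set.Iio T) :=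
    hFc.isOpen_support.inter isOpen_Iio
  have hFt₀ : 0 < F t₀ :=
    add_pos_of_nonneg_of_pos (sq_nonneg _)
      (mul_pos (hcoef t₀ hlt) (sq_pos_of_ne_zero hVt₀))
  exact hopen.measure_pos _ ⟨t₀, hFt₀.ne', hlt⟩
end

section
/- Let λ > 0 and C > 0. Suppose α : ℝ → ℝ is of class C⁴ and set τ(r) = α''(r) − λ·sin(α(r))·cos(α(r)). Assume that τ''(r) = λ·cos(2·α(r))·τ(r) for all r ∈ ℝ and that τ(r)² = C² for all r ∈ ℝ. Then α is constant and cos(2·α) = 0; in particular α ≡ π/4 + kπ/2 for some integer k. -/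
/-- Biharmonic equivariant maps from a cylinder to a sphere whose
tension field has constant nonzero norm are constant. Let `λ, C > 0`, `α : ℝ → ℝ` of
class `C⁴`, `τ = α'' − λ·sin α·cos α`. If `τ'' = λ·cos(2α)·τ` (biharmonicity) and
`τ² = C²` everywhere, then `α` is constant with `cos(2α) = 0`; in particular
`α ≡ π/4 + kπ/2` for some integer `k`. -/
theorem stmt_17 (lam C : ℝ) (hlam : 0 < lam) (hC : 0 < C)
    (α : ℝ → ℝ) (hα : ContDiff ℝ 4 α)
    (τ : ℝ → ℝ)
    (hτ : ∀ r : ℝ, τ r = deriv (deriv α) r - lam * Real.sin (α r) * Real.cos (α r))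
    (hbih : ∀ r : ℝ, deriv (deriv τ) r = lam * Real.cos (2 * α r) * τ r)
    (hconst : ∀ r : ℝ, (τ r) ^ 2 = C ^ 2) :
    (∀ r s : ℝ, α r = α s) ∧
    (∀ r : ℝ, Real.cos (2 * α r) = 0) ∧
    (∃ k : ℤ, ∀ r : ℝ, α r = Real.pi / 4 + k * (Real.pi / 2)) := by
  have hα₁ : ContDiff ℝ 3 (deriv α) := hα.deriv'
  have hα₂ : Continuous (deriv (deriv α)) := hα₁.continuous_deriv (by norm_num)
  have hcont : Continuous τ := by
    rw [funext hτ]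
    have := hα.continuous
    fun_prop
  have hτ_const : ∃ c : ℝ, τ = fun _ ↦ c := by
    rcases isPreconnected_univ.eq_or_eq_neg_of_sq_eq hcont.continuousOn
      (continuousOn_const (c := C)) (fun r _ ↦ hconst r) (fun _ ↦ hC.ne') with h | h
    · exact ⟨C, funext fun r ↦ h (Set.mem_univ r)⟩
    · exact ⟨-C, funext fun r ↦ h (Set.mem_univ r)⟩
  have hcos : ∀ r : ℝ, Real.cos (2 * α r) = 0 := by
    intro r
    have hne : τ r ≠ 0 := fun h ↦ by
      have := hconst r
      rw [h] at this
      nlinarith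
    have hb : deriv (deriv τ) r = 0 := by
      obtain ⟨c, rfl⟩ := hτ_const
      simp
    rw [hbih r] at hb
    simpa [hlam.ne', hne] using hb
  have hdiff : Differentiable ℝ α := hα.differentiable (by norm_num)
  have hderiv : ∀ r : ℝ, deriv α r = 0 := by
    intro r
    have h := ((hdiff r).hasDerivAt.const_mul 2).cos.deriv
    rw [funext hcos, deriv_const] at h
    have hsin : Real.sin (2 * α r) ≠ 0 := fun hs ↦ by
      have := Real.sin_sq_add_cos_sq (2 * α r)
      simp [hs, hcos r] at this
    simpa [hsin] using h.symm
  have hα_const : ∀ r s : ℝ, α r = α s := is_const_of_deriv_eq_zero hdiff hderiv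
  refine ⟨hα_const, hcos, ?_⟩
  obtain ⟨k, hk⟩ := Real.cos_eq_zero_iff.mp (hcos 0)
  refine ⟨k, fun r ↦ ?_⟩
  rw [hα_const r 0]
  linarith
end

section
/- Let λ > 0 and C > 0. Then: (i) there is no C⁴ function α : ℝ → ℝ such that, with τ(r) = α''(r) − λ·α(r), one has τ''(r) = λ·τ(r) and τ(r)² = C² for all r ∈ ℝ; and (ii) there is no C⁴ function α : ℝ → ℝ such that, with τ(r) = α''(r) − λ·sinh(α(r))·cosh(α(r)), one has τ''(r) = λ·cosh(2·α(r))·τ(r) and τ(r)² = C² for all r ∈ ℝ. -/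
/-- A real function whose square is a nonzero constant cannot satisfy `τ'' = k τ` at a point where
`k` is positive. -/
theorem not_deriv_deriv_eq_of_sq_eq {τ : ℝ → ℝ} {C k x : ℝ} (hC : 0 < C) (hk : 0 < k)
    (hτ : Differentiable ℝ τ) (hsq : ∀ r, τ r ^ 2 = C ^ 2) :
    deriv (deriv τ) x ≠ k * τ x := by
  have hne : ∀ r, τ r ≠ 0 := fun r h => by
    have := hsq r
    rw [h] at this
    nlinarith
  have hderiv : deriv τ = fun _ => 0 := by
    funext r
    have h₁ : HasDerivAt (fun s => τ s ^ 2) (2 * τ r * deriv τ r) r := by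
      simpa using (hτ r).hasDerivAt.fun_pow 2
    have h₂ : HasDerivAt (fun s => τ s ^ 2) 0 r := by
      simpa only [hsq] using hasDerivAt_const r (C ^ 2)
    simpa [hne r] using h₁.unique h₂
  rw [hderiv, deriv_const]
  exact (mul_ne_zero hk.ne' (hne x)).symm

/-- The second derivative of a `C⁴` real function is differentiable. -/
theorem ContDiff.differentiable_deriv_deriv {α : ℝ → ℝ} (h : ContDiff ℝ 4 α) :
    Differentiable ℝ (deriv (deriv α)) := by
  have h₃ : ContDiff ℝ (2 + 1 + 1) α := h.of_le (by norm_num)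
  exact ((contDiff_succ_iff_deriv.1 (contDiff_succ_iff_deriv.1 h₃).2.2).2.2).differentiable
    (by norm_num)

/-- There exists no equivariant proper biharmonic map from a cylinder
to `ℝ^m` or `H^m` whose tension field has constant nonzero norm. Let `λ, C > 0`. Then:
(i) there is no `C⁴` function `α` such that `τ = α'' − λα` satisfies `τ'' = λτ` and
`τ² = C²` everywhere; (ii) there is no `C⁴` function `α` such that
`τ = α'' − λ·sinh α·cosh α` satisfies `τ'' = λ·cosh(2α)·τ` and `τ² = C²` everywhere. -/
theorem stmt_18 (lam C : ℝ) (hlam : 0 < lam) (hC : 0 < C) :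
    (¬ ∃ α : ℝ → ℝ, ContDiff ℝ 4 α ∧
      (∀ r : ℝ,
        deriv (deriv (fun s => deriv (deriv α) s - lam * α s)) r
          = lam * (deriv (deriv α) r - lam * α r)) ∧
      (∀ r : ℝ, (deriv (deriv α) r - lam * α r) ^ 2 = C ^ 2)) ∧
    (¬ ∃ α : ℝ → ℝ, ContDiff ℝ 4 α ∧
      (∀ r : ℝ,
        deriv (deriv (fun s =>
            deriv (deriv α) s - lam * Real.sinh (α s) * Real.cosh (α s))) r
          = lam * Real.cosh (2 * α r)
              * (deriv (deriv α) r - lam * Real.sinh (α r) * Real.cosh (α r))) ∧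
      (∀ r : ℝ,
        (deriv (deriv α) r - lam * Real.sinh (α r) * Real.cosh (α r)) ^ 2 = C ^ 2)) := by
  constructor
  · rintro ⟨α, hα, hode, hsq⟩
    have h₀ : Differentiable ℝ α := hα.differentiable (by norm_num)
    have h₂ := hα.differentiable_deriv_deriv
    exact not_deriv_deriv_eq_of_sq_eq hC hlam (by fun_prop) hsq (hode 0)
  · rintro ⟨α, hα, hode, hsq⟩
    have h₀ : Differentiable ℝ α := hα.differentiable (by norm_num)
    have h₂ := hα.differentiable_deriv_deriv
    exact not_deriv_deriv_eq_of_sq_eq hC (mul_pos hlam (Real.cosh_pos _)) (by fun_prop) hsq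
      (hode 0)
end

section
/- Consider the inversion u : ℝ⁴ ∖ {0} → ℝ⁴ defined by u(x) = x/‖x‖², with component functions u_i(x) = x_i/‖x‖² for i = 1,…,4. Then for every x ≠ 0 and every i: the Euclidean Laplacian Δu_i(x) = Σ_{j=1}^{4} ∂²u_i/∂x_j²(x) equals −4·x_i/‖x‖⁴, and Δ(Δu_i)(x) = 0. In particular Δu(x) ≠ 0 for every x ≠ 0, while Δ²u ≡ 0, so u is a proper biharmonic map. -/
/-- The Euclidean Laplacian `Δg(x) = Σⱼ ∂²g/∂xⱼ²(x)` of a function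
`g : ℝ⁴ → ℝ` at a point `x`. -/
noncomputable def euclideanLaplacian (g : EuclideanSpace ℝ (Fin 4) → ℝ)
    (x : EuclideanSpace ℝ (Fin 4)) : ℝ :=
  ∑ j : Fin 4,
    fderiv ℝ (fun y => fderiv ℝ g y (EuclideanSpace.single j 1)) x
      (EuclideanSpace.single j 1)

/-- The Fréchet derivative of `‖y‖⁻²ᵏ` away from the origin. -/
lemma hasFDerivAt_inv_norm_sq_pow {E : Type*} [NormedAddCommGroup E] [InnerProductSpace ℝ E]
    (k : ℕ) {x : E} (hx : x ≠ 0) :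
    HasFDerivAt (fun y : E => ((‖y‖ ^ 2) ^ k)⁻¹)
      ((-(2 * k) * ((‖x‖ ^ 2) ^ (k + 1))⁻¹ : ℝ) • innerSL ℝ x) x := by
  have hq : ‖x‖ ^ 2 ≠ 0 := by simpa using hx
  have h₁ : HasDerivAt (fun t : ℝ => (t ^ k)⁻¹) (-k * ((‖x‖ ^ 2) ^ (k + 1))⁻¹) (‖x‖ ^ 2) := by
    have h := hasDerivAt_zpow (-(k : ℤ)) (‖x‖ ^ 2) (Or.inl hq)
    have e : -(k : ℤ) - 1 = -((k + 1 : ℕ) : ℤ) := by push_cast; ring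
    rw [e] at h
    simpa only [zpow_neg, zpow_natCast, Int.cast_neg, Int.cast_natCast] using h
  have h₂ : HasFDerivAt (fun y : E => ‖y‖ ^ 2) (2 • innerSL ℝ x) x :=
    (hasStrictFDerivAt_norm_sq x).hasFDerivAt
  refine (h₁.comp_hasFDerivAt x h₂).congr_fderiv ?_
  ext v
  simp
  ring

lemma hasFDerivAt_euclideanSpace_apply {ι : Type*} [Fintype ι] (i : ι) (x : EuclideanSpace ℝ ι) :
    HasFDerivAt (fun y : EuclideanSpace ℝ ι => y i) (EuclideanSpace.proj (𝕜 := ℝ) i) x :=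
  (EuclideanSpace.proj (𝕜 := ℝ) i : EuclideanSpace ℝ ι →L[ℝ] ℝ).hasFDerivAt

lemma euclideanLaplacian_congr {f g : EuclideanSpace ℝ (Fin 4) → ℝ}
    {x : EuclideanSpace ℝ (Fin 4)} (h : f =ᶠ[nhds x] g) :
    euclideanLaplacian f x = euclideanLaplacian g x := by
  refine Finset.sum_congr rfl fun j _ => ?_
  have h' : (fun y => fderiv ℝ f y (EuclideanSpace.single j 1)) =ᶠ[nhds x]
      fun y => fderiv ℝ g y (EuclideanSpace.single j 1) :=
    (h.fderiv (𝕜 := ℝ)).mono fun y hy => by simp only [hy]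
  rw [h'.fderiv_eq]

/-- In `ℝ⁴`, `Δ(c yᵢ ‖y‖⁻²ᵏ) = 4k(k - 2) c xᵢ ‖x‖⁻²ᵏ⁻²` away from the origin. -/
lemma euclideanLaplacian_coord_mul_inv_norm_sq_pow (c : ℝ) (k : ℕ) (i : Fin 4)
    {x : EuclideanSpace ℝ (Fin 4)} (hx : x ≠ 0) :
    euclideanLaplacian (fun y => c * (y i * ((‖y‖ ^ 2) ^ k)⁻¹)) x =
      4 * k * (k - 2) * c * (x i * ((‖x‖ ^ 2) ^ (k + 1))⁻¹) := by
  have hq : ‖x‖ ^ 2 ≠ 0 := by simpa using hx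
  have first (j : Fin 4) : (fun y => fderiv ℝ (fun y : EuclideanSpace ℝ (Fin 4) =>
      c * (y i * ((‖y‖ ^ 2) ^ k)⁻¹)) y (EuclideanSpace.single j 1)) =ᶠ[nhds x]
      fun y => c * ((if i = j then 1 else 0) * ((‖y‖ ^ 2) ^ k)⁻¹
        + (-(2 * k)) * (y i * y j * ((‖y‖ ^ 2) ^ (k + 1))⁻¹)) := by
    filter_upwards [isOpen_ne.mem_nhds hx] with y hy
    rw [(((hasFDerivAt_euclideanSpace_apply i y).fun_mul
      (hasFDerivAt_inv_norm_sq_pow k hy)).const_mul c).fderiv]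
    simp [EuclideanSpace.inner_single_right, PiLp.single_apply]
    split_ifs <;> ring
  have second (j : Fin 4) : fderiv ℝ (fun y => fderiv ℝ (fun y : EuclideanSpace ℝ (Fin 4) =>
      c * (y i * ((‖y‖ ^ 2) ^ k)⁻¹)) y (EuclideanSpace.single j 1)) x
        (EuclideanSpace.single j 1) =
      c * (-(2 * k) * ((‖x‖ ^ 2) ^ (k + 1))⁻¹ * (2 * ((if i = j then 1 else 0) * x j) + x i)
        + 4 * k * (k + 1) * x i * ((‖x‖ ^ 2) ^ (k + 2))⁻¹ * x j ^ 2) := by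
    rw [(first j).fderiv_eq,
      ((((hasFDerivAt_inv_norm_sq_pow k hx).const_mul (if i = j then (1 : ℝ) else 0)).fun_add
        ((((hasFDerivAt_euclideanSpace_apply i x).fun_mul (hasFDerivAt_euclideanSpace_apply j x)).fun_mul
          (hasFDerivAt_inv_norm_sq_pow (k + 1) hx)).const_mul (-(2 * k : ℝ)))).const_mul c).fderiv]
    by_cases h : i = j <;> simp [h, EuclideanSpace.inner_single_right] <;> ring
  have hsum : ∑ j, x j ^ 2 = ‖x‖ ^ 2 := (EuclideanSpace.real_norm_sq_eq x).symm
  have hpow : ((‖x‖ ^ 2) ^ (k + 2))⁻¹ * ‖x‖ ^ 2 = ((‖x‖ ^ 2) ^ (k + 1))⁻¹ := by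
    rw [pow_succ _ (k + 1), mul_inv, inv_mul_cancel_right₀ hq]
  unfold euclideanLaplacian
  simp only [second]
  rw [← Finset.mul_sum, Finset.sum_add_distrib, ← Finset.mul_sum, ← Finset.mul_sum, hsum,
    Finset.sum_add_distrib, ← Finset.mul_sum, mul_assoc _ _ (‖x‖ ^ 2), hpow]
  simp
  ring

/-- The inversion `u(x) = x/‖x‖²` of `ℝ⁴ ∖ {0}`, with components
`uᵢ(x) = xᵢ/‖x‖²`, satisfies `Δuᵢ(x) = −4xᵢ/‖x‖⁴` and `Δ(Δuᵢ)(x) = 0` for every `x ≠ 0`;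
in particular `Δu(x) ≠ 0` for every `x ≠ 0` while `Δ²u ≡ 0`, so `u` is a proper
biharmonic map. -/
theorem stmt_19 :
    ∀ x : EuclideanSpace ℝ (Fin 4), x ≠ 0 →
      (∀ i : Fin 4,
        euclideanLaplacian (fun y => y i / ‖y‖ ^ 2) x = -4 * x i / ‖x‖ ^ 4) ∧
      (∀ i : Fin 4,
        euclideanLaplacian (euclideanLaplacian (fun y => y i / ‖y‖ ^ 2)) x = 0) ∧
      ¬ (∀ i : Fin 4, euclideanLaplacian (fun y => y i / ‖y‖ ^ 2) x = 0) := by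
  have hlap (i : Fin 4) {x : EuclideanSpace ℝ (Fin 4)} (hx : x ≠ 0) :
      euclideanLaplacian (fun y => y i / ‖y‖ ^ 2) x = -4 * (x i * ((‖x‖ ^ 2) ^ 2)⁻¹) := by
    have h := euclideanLaplacian_coord_mul_inv_norm_sq_pow 1 1 i hx
    simp only [one_mul, pow_one, ← div_eq_mul_inv] at h
    rw [h]
    norm_num
    ring
  intro x hx
  refine ⟨fun i => ?_, fun i => ?_, fun h => hx ?_⟩
  · rw [hlap i hx]
    ring
  · have h : euclideanLaplacian (fun y => y i / ‖y‖ ^ 2) =ᶠ[nhds x]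
        fun y => -4 * (y i * ((‖y‖ ^ 2) ^ 2)⁻¹) := by
      filter_upwards [isOpen_ne.mem_nhds hx] with y hy using hlap i hy
    rw [euclideanLaplacian_congr h, euclideanLaplacian_coord_mul_inv_norm_sq_pow _ _ _ hx]
    norm_num
  · ext i
    have hi := h i
    rw [hlap i hx] at hi
    simpa [hx] using hi
end
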